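/- arXiv:1602.08965 — 3 statements merged into one kernel-verified Lean document; each statement's English description precedes it below -/
import Mathlib

section
/- For n ≥ 3, a word w with A(w) = {1, 2, …, n} is a 132-avoiding word representing the complete graph K_n on vertex set {1, 2, …, n} if and only if w has exactly one of the following forms: (i) w = (n−1)·n·1·2·⋯·n·1 (the letter n−1, then n, then the increasing word 1 2 ⋯ n, then 1); (ii) w = (n−1)·n·u·(n−1)·n, where u is a 132-avoiding permutation of {1, 2, …, n−2}; (iii) w = n·1·2·⋯·n·1; (iv) w = n·u·n, where u is a 132-avoiding permutation of {1, 2, …, n−1}; (v) w is a 132-avoiding permutation of {1, 2, …, n}; (vi) w = i·(i+1)·⋯·n·u·i for some 1 ≤ i ≤ n−1, where u is a 132-avoiding permutation of {1, 2, …, i−1}. -/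
/-- Distinct letters `x` and `y` alternate in the word `w`: the subsequence of `w`
formed by all occurrences of `x` and `y` has no two equal consecutive letters. -/
def Alternate (w : List ℕ) (x y : ℕ) : Prop :=
  (w.filter (fun c => decide (c = x ∨ c = y))).Chain' (· ≠ ·)

/-- The word `w` avoids the pattern 132. -/
def Avoids132 (w : List ℕ) : Prop :=
  ∀ i j k : Fin w.length, i < j → j < k →
    ¬ (w.get i < w.get k ∧ w.get k < w.get j)

/-- The word `w` represents the simple graph `G`: the vertex set of `G` is the set
`A(w)` of letters of `w` (all other vertices of the ambient type `ℕ` are isolated),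
and two distinct letters of `w` are adjacent iff they alternate in `w`. -/
def Represents (w : List ℕ) (G : SimpleGraph ℕ) : Prop :=
  (∀ x y, G.Adj x y → x ∈ w) ∧
  (∀ x y : ℕ, x ≠ y → x ∈ w → y ∈ w → (G.Adj x y ↔ Alternate w x y))

/-- A graph is 132-representable if some simple graph on a set of natural numbers
isomorphic to it is represented by a 132-avoiding word. -/
def Representable132 {V : Type*} (G : SimpleGraph V) : Prop :=
  ∃ (w : List ℕ) (H : SimpleGraph ℕ), Avoids132 w ∧ Represents w H ∧
    Nonempty (G ≃g H.induce (↑w.toFinset : Set ℕ))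

/-- The complete graph `K n` on vertex set `{1, …, n}`: two distinct vertices are
adjacent iff both lie in `{1, …, n}` (all other vertices of `ℕ` are isolated). -/
def completeOn (n : ℕ) : SimpleGraph ℕ :=
  SimpleGraph.fromRel (fun x y => 1 ≤ x ∧ x ≤ n ∧ 1 ≤ y ∧ y ≤ n)

/-- `u` is a permutation of the finite set `S` of natural numbers: a word in which
each element of `S` occurs exactly once and no other letters occur. -/
def IsPermOf (u : List ℕ) (S : Finset ℕ) : Prop :=
  u.Nodup ∧ u.toFinset = S

/-- Form (i): `w = (n-1) n 1 2 ⋯ n 1`. -/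
def Form1 (n : ℕ) (w : List ℕ) : Prop :=
  w = [n - 1, n] ++ (List.range n).map (· + 1) ++ [1]

/-- Form (ii): `w = (n-1) n u (n-1) n` with `u` a 132-avoiding permutation of
`{1, …, n-2}`. -/
def Form2 (n : ℕ) (w : List ℕ) : Prop :=
  ∃ u, Avoids132 u ∧ IsPermOf u (Finset.Icc 1 (n - 2)) ∧
    w = [n - 1, n] ++ u ++ [n - 1, n]

/-- Form (iii): `w = n 1 2 ⋯ n 1`. -/
def Form3 (n : ℕ) (w : List ℕ) : Prop :=
  w = n :: ((List.range n).map (· + 1) ++ [1])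

/-- Form (iv): `w = n u n` with `u` a 132-avoiding permutation of `{1, …, n-1}`. -/
def Form4 (n : ℕ) (w : List ℕ) : Prop :=
  ∃ u, Avoids132 u ∧ IsPermOf u (Finset.Icc 1 (n - 1)) ∧ w = n :: (u ++ [n])

/-- Form (v): `w` is a 132-avoiding permutation of `{1, …, n}`. -/
def Form5 (n : ℕ) (w : List ℕ) : Prop :=
  Avoids132 w ∧ IsPermOf w (Finset.Icc 1 n)

/-- Form (vi): `w = i (i+1) ⋯ n u i` for some `1 ≤ i ≤ n-1`, with `u` a
132-avoiding permutation of `{1, …, i-1}`. -/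
def Form6 (n : ℕ) (w : List ℕ) : Prop :=
  ∃ i u, 1 ≤ i ∧ i ≤ n - 1 ∧ Avoids132 u ∧ IsPermOf u (Finset.Icc 1 (i - 1)) ∧
    w = (List.range (n - i + 1)).map (· + i) ++ u ++ [i]

theorem avoids132_cons {a : ℕ} {w : List ℕ} :
    Avoids132 (a :: w) ↔ w.Pairwise (fun y z => ¬ (a < z ∧ z < y)) ∧ Avoids132 w := by
  constructor
  · intro h
    refine ⟨List.pairwise_iff_get.2 fun i j hij => ?_, fun i j k hij hjk => ?_⟩
    · simpa using h ⟨0, by simp⟩ i.succ j.succ (Fin.succ_pos i) (Fin.succ_lt_succ_iff.2 hij)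
    · simpa using h i.succ j.succ k.succ (Fin.succ_lt_succ_iff.2 hij) (Fin.succ_lt_succ_iff.2 hjk)
  · rintro ⟨h₁, h₂⟩ ⟨i, hi⟩ ⟨j, hj⟩ ⟨k, hk⟩ hij hjk
    rw [List.pairwise_iff_get] at h₁
    simp only [Fin.mk_lt_mk, List.length_cons] at hij hjk hi hj hk
    obtain _ | j := j
    · omega
    obtain _ | k := k
    · omega
    obtain _ | i := i
    · simpa using h₁ ⟨j, by omega⟩ ⟨k, by omega⟩ (by simpa using hjk)
    · simpa using h₂ ⟨i, by omega⟩ ⟨j, by omega⟩ ⟨k, by omega⟩ (by simpa using hij)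
        (by simpa using hjk)

theorem avoids132_nil : Avoids132 [] := fun i => i.elim0

theorem avoids132_append {l u : List ℕ} :
    Avoids132 (l ++ u) ↔ Avoids132 l ∧ Avoids132 u ∧
      (∀ z ∈ u, l.Pairwise (fun x y => ¬ (x < z ∧ z < y))) ∧
      (∀ x ∈ l, u.Pairwise (fun y z => ¬ (x < z ∧ z < y))) := by
  induction l with
  | nil => simp [avoids132_nil]
  | cons a l ih =>
    rw [List.cons_append, avoids132_cons, avoids132_cons, ih]
    simp only [List.pairwise_append, List.mem_cons, List.pairwise_cons, forall_eq_or_imp]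
    constructor
    · rintro ⟨⟨h₁, h₂, h₃⟩, h₄, h₅, h₆, h₇⟩
      exact ⟨⟨h₁, h₄⟩, h₅, fun z hz => ⟨fun y hy => h₃ y hy z hz, h₆ z hz⟩, h₂, h₇⟩
    · rintro ⟨⟨h₁, h₄⟩, h₅, h₆, h₂, h₇⟩
      exact ⟨⟨h₁, h₂, fun y hy z hz => (h₆ z hz).1 y hy⟩, h₄, h₅, fun z hz => (h₆ z hz).2, h₇⟩

theorem Avoids132.of_sublist {u w : List ℕ} (hw : Avoids132 w) (h : u.Sublist w) :
    Avoids132 u := by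
  induction h with
  | slnil => exact hw
  | cons a _ ih => exact ih (avoids132_cons.1 hw).2
  | cons_cons a h ih =>
    rw [avoids132_cons] at hw ⊢
    exact ⟨hw.1.sublist h, ih hw.2⟩

theorem Avoids132.not_sublist {w : List ℕ} (hw : Avoids132 w) {x y z : ℕ}
    (h : [x, y, z].Sublist w) : ¬ (x < z ∧ z < y) := by
  have := hw.of_sublist h
  rw [avoids132_cons] at this
  simpa using this.1

theorem avoids132_of_pairwise_lt {w : List ℕ} (h : w.Pairwise (· < ·)) : Avoids132 w := by
  induction w with
  | nil => exact avoids132_nil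
  | cons a w ih =>
    rw [List.pairwise_cons] at h
    exact avoids132_cons.2 ⟨h.2.imp fun hyz => by omega, ih h.2⟩

theorem map_add_range_eq_range' (i m : ℕ) :
    (List.range m).map (· + i) = List.range' i m := by
  rw [List.range'_eq_map_range]
  exact List.map_congr_left fun x _ => Nat.add_comm x i

theorem IsPermOf.mem_iff {u : List ℕ} {S : Finset ℕ} (h : IsPermOf u S) (x : ℕ) :
    x ∈ u ↔ x ∈ S := by
  rw [← h.2, List.mem_toFinset]

theorem IsPermOf.length_eq {u : List ℕ} {S : Finset ℕ} (h : IsPermOf u S) :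
    u.length = S.card := by
  rw [← h.2, List.toFinset_card_of_nodup h.1]

theorem isPermOf_iff {u : List ℕ} {S : Finset ℕ} :
    IsPermOf u S ↔ u.Nodup ∧ ∀ x, x ∈ u ↔ x ∈ S := by
  simp [IsPermOf, Finset.ext_iff]

theorem alternate_iff {w : List ℕ} {x y : ℕ} :
    Alternate w x y ↔ (w.filter (fun c => decide (c = x ∨ c = y))).IsChain (· ≠ ·) :=
  Iff.rfl

theorem Alternate.of_append {u v : List ℕ} {x y : ℕ} (h : Alternate (u ++ v) x y) :
    Alternate u x y := by
  rw [alternate_iff] at *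
  rw [List.filter_append] at h
  exact h.left_of_append

/-- Between two consecutive occurrences of `a`, every letter alternating with `a` occurs. -/
theorem Alternate.mem_of_return {s t : List ℕ} {a y : ℕ}
    (h : Alternate (s ++ a :: t ++ [a]) a y) (ht : a ∉ t) : y ∈ t := by
  by_contra hy
  have hf : t.filter (fun c => decide (c = a ∨ c = y)) = [] := by
    simp only [List.filter_eq_nil_iff, decide_eq_true_eq]
    rintro c hc (rfl | rfl)
    · exact ht hc
    · exact hy hc
  rw [alternate_iff] at h
  simp only [List.filter_append, List.filter_cons, hf] at h
  simp [List.isChain_append] at h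

theorem eq_nil_of_returns {S : Finset ℕ} {r s t : List ℕ} {a : ℕ}
    (hS : ∀ x ∈ s ++ a :: t, x ∈ S) (hd : (s ++ a :: t).Nodup)
    (h : ∀ y ∈ S, y ≠ a → Alternate (r ++ (s ++ a :: t) ++ [a]) a y) :
    s = [] ∧ IsPermOf (a :: t) S := by
  have hat : a ∉ t := (List.nodup_cons.1 (List.nodup_append.1 hd).2.1).1
  have hmem : ∀ y ∈ S, y ≠ a → y ∈ t := fun y hy hya =>
    Alternate.mem_of_return (s := r ++ s) (by simpa using h y hy hya) hat
  have hs : s = [] := by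
    rw [List.eq_nil_iff_forall_not_mem]
    intro y hy
    have hya : y ≠ a := fun e => (List.nodup_append.1 hd).2.2 y hy a (by simp) e
    exact (List.nodup_append.1 hd).2.2 y hy y
      (List.mem_cons_of_mem _ (hmem y (hS y (by simp [hy])) hya)) rfl
  subst hs
  refine ⟨rfl, isPermOf_iff.2 ⟨hd, fun x => ⟨hS x, fun hx => ?_⟩⟩⟩
  by_cases e : x = a
  · simp [e]
  · exact List.mem_cons_of_mem _ (hmem x hx e)

theorem IsPermOf.rotate {S : Finset ℕ} {a : ℕ} {t : List ℕ} (h : IsPermOf (a :: t) S) :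
    IsPermOf (t ++ [a]) S := by
  rw [isPermOf_iff] at *
  refine ⟨(List.perm_append_singleton a t).nodup_iff.2 h.1, fun x => ?_⟩
  rw [← h.2 x, (List.perm_append_singleton a t).mem_iff]

/-- A word in which all letters of `S` pairwise alternate has no repetition, or
it is periodic with period a permutation of `S`. -/
theorem nodup_or_periodic_of_alternate {S : Finset ℕ} (w : List ℕ) (hS : ∀ x ∈ w, x ∈ S)
    (h : ∀ x ∈ S, ∀ y ∈ S, y ≠ x → Alternate w x y) :
    w.Nodup ∨ ∃ p v q, w = p ++ v ∧ w = v ++ q ∧ IsPermOf p S ∧ IsPermOf q S := by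
  induction w using List.reverseRecOn with
  | nil => simp
  | append_singleton w a ih =>
    have haS : a ∈ S := hS a (by simp)
    rcases ih (fun x hx => hS x (by simp [hx])) (fun x hx y hy e => (h x hx y hy e).of_append)
      with hd | ⟨p, v, q, hp, hq, hpS, hqS⟩
    · by_cases ha : a ∈ w
      · right
        obtain ⟨s, t, rfl⟩ := List.append_of_mem ha
        obtain ⟨rfl, ht⟩ := eq_nil_of_returns (r := [])
          (fun x hx => hS x (List.mem_append_left _ hx)) hd
          (fun y hy e => by simpa using h a haS y hy e)
        exact ⟨a :: t, [a], t ++ [a], by simp, by simp, ht, ht.rotate⟩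
      · left
        rw [(List.perm_append_singleton a w).nodup_iff]
        exact List.nodup_cons.2 ⟨ha, hd⟩
    · right
      obtain ⟨s, t, rfl⟩ := List.append_of_mem ((hqS.mem_iff a).2 haS)
      obtain ⟨rfl, ht⟩ := eq_nil_of_returns (r := v) (fun x hx => (hqS.mem_iff x).1 hx) hqS.1
          (fun y hy e => by simpa [hq] using h a haS y hy e)
      exact ⟨p, v ++ [a], t ++ [a], by simp [hp], by simp [hq], hpS, ht.rotate⟩

theorem alternate_of_nodup {v q : List ℕ} (hd : (v ++ q).Nodup) {x y : ℕ} (hxy : x ≠ y)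
    (hx : x ∈ v ++ q) (hy : y ∈ v ++ q) : Alternate (v ++ q ++ v) x y := by
  rw [alternate_iff, List.filter_append]
  have hperm : ((v ++ q).filter (fun c => decide (c = x ∨ c = y))).Perm [x, y] := by
    rw [List.perm_ext_iff_of_nodup (hd.filter _) (by simp [hxy])]
    intro c
    simp only [List.mem_filter, decide_eq_true_eq, List.mem_cons, List.not_mem_nil, or_false]
    constructor
    · exact fun h => h.2
    · rintro (rfl | rfl) <;> simp_all
  have hd' := hd.filter (fun c => decide (c = x ∨ c = y))
  have hl := hperm.length_eq
  rw [List.filter_append] at hd' hl ⊢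
  generalize v.filter (fun c => decide (c = x ∨ c = y)) = L at *
  generalize q.filter (fun c => decide (c = x ∨ c = y)) = M at *
  rcases L with _ | ⟨a, _ | ⟨b, _ | ⟨c, L⟩⟩⟩
  · simpa using hd'.isChain
  · rcases M with _ | ⟨b, _ | ⟨c, M⟩⟩ <;> simp_all [eq_comm]
  · rcases M with _ | ⟨c, M⟩ <;> simp_all [eq_comm]
  · simp at hl

theorem eq_range'_append_of_return {n a : ℕ} {t : List ℕ} (hp : IsPermOf (a :: t) (Finset.Icc 1 n))
    (hw : Avoids132 (a :: t ++ [a])) :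
    ∃ u, Avoids132 u ∧ IsPermOf u (Finset.Icc 1 (a - 1)) ∧
      a :: t = List.range' a (n - a + 1) ++ u := by
  have hd := List.nodup_cons.1 hp.1
  have hmem : ∀ x, x = a ∨ x ∈ t ↔ 1 ≤ x ∧ x ≤ n := by simpa using hp.mem_iff
  have ha := (hmem a).1 (Or.inl rfl)
  rw [List.cons_append, avoids132_cons, avoids132_append] at hw
  obtain ⟨h₁, h₂, -, h₃, -⟩ := hw
  replace h₁ := (List.pairwise_append.1 h₁).1
  replace h₃ := h₃ a (by simp)
  have hsplit : t = t.filter (fun x => a < x) ++ t.filter (fun x => x < a) := by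
    clear hmem hp h₁ h₂ ha
    induction t with
    | nil => rfl
    | cons b t ih =>
      simp only [List.pairwise_cons, List.mem_cons, not_or, List.nodup_cons] at hd h₃
      specialize ih ⟨hd.1.2, hd.2.2⟩ h₃.2
      rcases lt_or_gt_of_ne hd.1.1 with hab | hab
      · rw [List.filter_cons_of_pos (by simpa using hab),
          List.filter_cons_of_neg (by simp; omega), List.cons_append, ← ih]
      · have hnil : t.filter (fun x => a < x) = [] := by
          simp only [List.filter_eq_nil_iff, decide_eq_true_eq]
          exact fun x hx hax => h₃.1 x hx ⟨hab, hax⟩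
        rw [hnil, List.nil_append] at ih
        rw [List.filter_cons_of_neg (by simp; omega), hnil,
          List.filter_cons_of_pos (by simpa using hab), List.nil_append, ← ih]
  refine ⟨t.filter (fun x => x < a), h₂.of_sublist List.filter_sublist,
    isPermOf_iff.2 ⟨hd.2.filter _, fun x => ?_⟩, ?_⟩
  · have := hmem x
    simp only [List.mem_filter, decide_eq_true_eq, Finset.mem_Icc]
    constructor
    · rintro ⟨hx, hxa⟩
      have := this.1 (Or.inr hx)
      omega
    · intro hx
      have h := this.2 (by omega)
      exact ⟨h.resolve_left (by omega), by omega⟩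
  · have hrange : t.filter (fun x => a < x) = List.range' (a + 1) (n - a) := by
      refine List.Perm.eq_of_pairwise (le := (· ≤ ·)) (fun _ _ _ _ => le_antisymm) ?_ ?_ ?_
      · rw [List.pairwise_filter]
        refine h₁.imp fun {y z} h hy hz => ?_
        simp only [decide_eq_true_eq] at hy hz
        omega
      · exact List.pairwise_le_range'
      · rw [List.perm_ext_iff_of_nodup (hd.2.filter _) List.nodup_range']
        intro x
        have := hmem x
        simp only [List.mem_filter, decide_eq_true_eq, List.mem_range'_1]
        constructor
        · rintro ⟨hx, hax⟩
          have := this.1 (Or.inr hx)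
          omega
        · intro hx
          exact ⟨(this.2 (by omega)).resolve_left (by omega), by omega⟩
    rw [List.range'_succ, List.cons_append, ← hrange, ← hsplit]

theorem eq_range'_of_return_one {n : ℕ} {t : List ℕ} (hp : IsPermOf (1 :: t) (Finset.Icc 1 n))
    (hw : Avoids132 (1 :: t ++ [1])) : 1 :: t = List.range' 1 n := by
  obtain ⟨u, -, hu, h⟩ := eq_range'_append_of_return hp hw
  have hn : 1 ≤ n := by simpa using (hp.mem_iff 1).1 (by simp)
  have hu' : u = [] := by simpa using hu.2
  rw [h, hu', List.append_nil, Nat.sub_add_cancel hn]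

theorem IsPermOf.tail_of_max {m : ℕ} {t : List ℕ}
    (h : IsPermOf ((m + 1) :: t) (Finset.Icc 1 (m + 1))) : IsPermOf t (Finset.Icc 1 m) := by
  rw [isPermOf_iff, List.nodup_cons] at *
  refine ⟨h.1.2, fun x => ?_⟩
  have hx := h.2 x
  simp only [List.mem_cons, Finset.mem_Icc] at hx ⊢
  by_cases e : x = m + 1
  · subst e
    simp [h.1.1]
  · rw [or_iff_right e] at hx
    rw [hx]
    omega

/-- A permutation `b :: t` of `1, …, m`, followed by a letter exceeding all others and
then by `b` again, avoids 132 only if `b = 1`. -/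
theorem eq_one_of_max_return {m M b : ℕ} {t : List ℕ} (hp : IsPermOf (b :: t) (Finset.Icc 1 m))
    (hM : m < M) (hw : Avoids132 (b :: t ++ [M, b])) : b = 1 := by
  by_contra hb
  have hmem : ∀ x, x = b ∨ x ∈ t ↔ 1 ≤ x ∧ x ≤ m := by simpa using hp.mem_iff
  have hbm := (hmem b).1 (Or.inl rfl)
  have h1 : 1 ∈ t := ((hmem 1).2 (by omega)).resolve_left (Ne.symm hb)
  have hs : [1, M, b].Sublist (b :: t ++ [M, b]) :=
    ((List.singleton_sublist.2 h1).append (List.Sublist.refl [M, b])).cons b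
  exact hw.not_sublist hs (by omega)

theorem eq_of_two_returns {n a b : ℕ} {t : List ℕ}
    (hp : IsPermOf (a :: b :: t) (Finset.Icc 1 n)) (hw : Avoids132 (a :: b :: t ++ [a, b])) :
    (a = n ∧ b = 1 ∧ b :: t = List.range' 1 (n - 1)) ∨
      (2 ≤ n ∧ a = n - 1 ∧ b = n ∧ IsPermOf t (Finset.Icc 1 (n - 2))) := by
  have hmem : ∀ x, x = a ∨ x = b ∨ x ∈ t ↔ 1 ≤ x ∧ x ≤ n := by simpa using hp.mem_iff
  have ha := (hmem a).1 (Or.inl rfl)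
  have hb := (hmem b).1 (Or.inr (Or.inl rfl))
  have hd := hp.1
  simp only [List.nodup_cons, List.mem_cons, not_or] at hd
  by_cases han : a = n
  · left
    obtain ⟨m, rfl⟩ : ∃ m, n = m + 1 := ⟨n - 1, by omega⟩
    subst han
    have hp' := hp.tail_of_max
    have hw' : Avoids132 (b :: t ++ [m + 1, b]) := (avoids132_cons.1 hw).2
    obtain rfl := eq_one_of_max_return hp' (Nat.lt_succ_self m) hw'
    refine ⟨rfl, rfl, eq_range'_of_return_one hp' (hw'.of_sublist ?_)⟩
    exact (List.Sublist.refl (1 :: t)).append (by simp)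
  · right
    obtain ⟨u, -, hu, h⟩ := eq_range'_append_of_return hp
      (hw.of_sublist ((List.Sublist.refl (a :: b :: t)).append (by simp)))
    obtain ⟨k, hk⟩ : ∃ k, n - a = k + 1 := ⟨n - a - 1, by omega⟩
    rw [hk, List.range'_succ, List.range'_succ] at h
    simp only [List.cons_append, List.cons.injEq, true_and] at h
    obtain ⟨rfl, ht⟩ := h
    have hn : a + 1 = n := by
      by_contra hne
      have hnt : n ∈ t := ((hmem n).2 (by omega)).resolve_left (by omega) |>.resolve_left (by omega)
      have hs : [a, n, a + 1].Sublist (a :: (a + 1) :: t ++ [a, a + 1]) := by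
        refine List.Sublist.cons_cons a (List.Sublist.cons _ ?_)
        have hr : [a + 1].Sublist [a, a + 1] := by simp
        exact (List.singleton_sublist.2 hnt).append hr
      exact hw.not_sublist hs (by omega)
    obtain rfl : k = 0 := by omega
    simp only [List.range'_zero, List.nil_append] at ht
    subst ht hn
    exact ⟨by omega, by omega, rfl, by simpa using hu⟩

theorem exists_form {n : ℕ} (hn : 3 ≤ n) {w : List ℕ} (hw : Avoids132 w)
    (hS : w.toFinset = Finset.Icc 1 n)
    (h : ∀ x ∈ Finset.Icc 1 n, ∀ y ∈ Finset.Icc 1 n, y ≠ x → Alternate w x y) :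
    Form1 n w ∨ Form2 n w ∨ Form3 n w ∨ Form4 n w ∨ Form5 n w ∨ Form6 n w := by
  rcases nodup_or_periodic_of_alternate w (fun x hx => by simpa [← hS] using hx) h with
    hd | ⟨p, v, q, rfl, hpq, hp, -⟩
  · exact Or.inr (Or.inr (Or.inr (Or.inr (Or.inl ⟨hw, hd, hS⟩))))
  have hlen := hp.length_eq
  rw [Nat.card_Icc, Nat.add_sub_cancel] at hlen
  match p, hlen, hp, hpq, hw with
  | [], hlen, _, _, _ => simp at hlen; omega
  | [_], hlen, _, _, _ => simp at hlen; omega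
  | [_, _], hlen, _, _, _ => simp at hlen; omega
  | a :: b :: c :: t, _, hp, hpq, hw =>
  have hmem : ∀ x, x = a ∨ x = b ∨ x = c ∨ x ∈ t ↔ 1 ≤ x ∧ x ≤ n := by simpa using hp.mem_iff
  have ha := (hmem a).1 (by simp)
  have hb := (hmem b).1 (by simp)
  have hc := (hmem c).1 (by simp)
  have hd := hp.1
  simp only [List.nodup_cons, List.mem_cons, not_or] at hd
  match v, hpq, hw with
  | [], _, hw =>
    rw [List.append_nil] at *
    exact Or.inr (Or.inr (Or.inr (Or.inr (Or.inl ⟨hw, hp⟩))))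
  | [a'], hpq, hw =>
    obtain rfl : a' = a := by simp at hpq; exact hpq.1.symm
    obtain ⟨u, hu, huS, h⟩ := eq_range'_append_of_return hp hw
    rw [h]
    by_cases han : a' = n
    · subst han
      right; right; right; left
      exact ⟨u, hu, huS, by simp⟩
    · right; right; right; right; right
      exact ⟨a', u, ha.1, by omega, hu, huS, by rw [map_add_range_eq_range']⟩
  | [a', b'], hpq, hw =>
    obtain ⟨rfl, rfl⟩ : a = a' ∧ b = b' := by simp at hpq; exact ⟨hpq.1, hpq.2.1⟩
    rcases eq_of_two_returns hp hw with ⟨rfl, rfl, ht⟩ | ⟨-, rfl, rfl, ht⟩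
    · right; right; left
      rw [Form3, map_add_range_eq_range', ht]
      obtain ⟨m, rfl⟩ : ∃ m, a = m + 1 := ⟨a - 1, by omega⟩
      rw [List.range'_concat]
      simp [Nat.add_comm]
    · right; left
      refine ⟨c :: t, hw.of_sublist ?_, ht, rfl⟩
      exact ((List.sublist_append_left _ _).cons _).cons _
  | a' :: b' :: c' :: v', hpq, hw =>
    obtain ⟨rfl, rfl, rfl⟩ : a = a' ∧ b = b' ∧ c = c' := by
      simp at hpq; exact ⟨hpq.1, hpq.2.1, hpq.2.2.1⟩
    rcases eq_of_two_returns hp (hw.of_sublist ((List.Sublist.refl _).append (by simp))) with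
      ⟨rfl, rfl, ht⟩ | ⟨-, rfl, rfl, ht⟩
    · have hs : [1, a, c].Sublist (a :: 1 :: c :: t ++ a :: 1 :: c :: v') := by
        refine List.Sublist.cons _ (List.Sublist.cons_cons 1 ?_)
        refine List.Sublist.trans ?_ (List.sublist_append_right (c :: t) _)
        simp
      exact absurd ⟨by omega, by omega⟩ (hw.not_sublist hs)
    · have hw' : Avoids132 (c :: t ++ [b - 1, b, c]) := by
        refine hw.of_sublist (((List.Sublist.refl (c :: t)).append ?_).cons _ |>.cons _)
        simp
      obtain rfl := eq_one_of_max_return ht (M := b) (by omega)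
        (hw'.of_sublist ((List.Sublist.refl (c :: t)).append (by simp)))
      have ht' := eq_range'_of_return_one ht
        (hw'.of_sublist ((List.Sublist.refl (1 :: t)).append (by simp)))
      rw [ht']
      match v', hpq, hw with
      | [], _, _ =>
        left
        rw [Form1, map_add_range_eq_range']
        obtain ⟨m, rfl⟩ : ∃ m, b = m + 2 := ⟨b - 2, by omega⟩
        rw [List.range'_concat, List.range'_concat]
        simp [Nat.add_comm, Nat.add_left_comm]
      | d :: v'', hpq, hw =>
        have hdS : d ∈ t ∨ d = b - 1 := by
          simp only [List.cons_append, List.cons.injEq, true_and] at hpq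
          cases t <;> simp_all
        have hdb : 1 < d ∧ d < b := by
          rcases hdS with hdt | rfl
          · have := (hmem d).1 (by simp [hdt])
            have h1 : d ≠ 1 := by rintro rfl; exact hd.2.2.1 hdt
            have h2 : d ≠ b := by rintro rfl; exact hd.2.1.2 hdt
            omega
          · omega
        have hs : [1, b, d].Sublist ((b - 1) :: b :: 1 :: t ++ (b - 1) :: b :: 1 :: d :: v'') := by
          refine List.Sublist.cons _ (List.Sublist.cons _ (List.Sublist.cons_cons 1 ?_))
          refine List.Sublist.trans ?_ (List.sublist_append_right t _)
          simp
        exact absurd hdb (hw.not_sublist hs)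

theorem representation_of_append {n : ℕ} {v q : List ℕ} (hw : Avoids132 (v ++ q ++ v))
    (hp : IsPermOf (v ++ q) (Finset.Icc 1 n)) :
    Avoids132 (v ++ q ++ v) ∧ (v ++ q ++ v).toFinset = Finset.Icc 1 n ∧
      ∀ x ∈ Finset.Icc 1 n, ∀ y ∈ Finset.Icc 1 n, y ≠ x → Alternate (v ++ q ++ v) x y := by
  refine ⟨hw, ?_, fun x hx y hy hyx => ?_⟩
  · rw [← hp.2]
    ext x
    simp only [List.mem_toFinset, List.mem_append]
    tauto
  · exact alternate_of_nodup hp.1 hyx.symm ((hp.mem_iff x).2 hx) ((hp.mem_iff y).2 hy)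

theorem represents_completeOn_iff {n : ℕ} {w : List ℕ} (hS : w.toFinset = Finset.Icc 1 n) :
    Represents w (completeOn n) ↔
      ∀ x ∈ Finset.Icc 1 n, ∀ y ∈ Finset.Icc 1 n, y ≠ x → Alternate w x y := by
  have hmem : ∀ x, x ∈ w ↔ 1 ≤ x ∧ x ≤ n := fun x => by
    rw [← List.mem_toFinset, hS, Finset.mem_Icc]
  simp only [Represents, completeOn, SimpleGraph.fromRel_adj, hmem, Finset.mem_Icc]
  constructor
  · intro h x hx y hy hyx
    exact (h.2 x y hyx.symm hx hy).1 ⟨hyx.symm, Or.inl ⟨hx.1, hx.2, hy⟩⟩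
  · intro h
    refine ⟨fun x y hxy => by omega, fun x y hxy hx hy =>
      ⟨fun _ => h x hx y hy hxy.symm, fun _ => ?_⟩⟩
    exact ⟨hxy, Or.inl ⟨hx.1, hx.2, hy⟩⟩

theorem avoids132_append_singleton {w : List ℕ} {a : ℕ} :
    Avoids132 (w ++ [a]) ↔ Avoids132 w ∧ w.Pairwise (fun x y => ¬ (x < a ∧ a < y)) := by
  rw [avoids132_append]
  simp [avoids132_cons, avoids132_nil]

theorem avoids132_cons_of_forall {w : List ℕ} {a : ℕ} (hw : Avoids132 w)
    (h : ∀ y ∈ w, ∀ z ∈ w, ¬ (a < z ∧ z < y)) : Avoids132 (a :: w) :=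
  avoids132_cons.2 ⟨List.pairwise_of_forall_mem_list h, hw⟩

theorem avoids132_append_singleton_of_forall {w : List ℕ} {a : ℕ} (hw : Avoids132 w)
    (h : ∀ x ∈ w, ∀ y ∈ w, ¬ (x < a ∧ a < y)) : Avoids132 (w ++ [a]) :=
  avoids132_append_singleton.2 ⟨hw, List.pairwise_of_forall_mem_list h⟩

theorem avoids132_range' (i m : ℕ) : Avoids132 (List.range' i m) :=
  avoids132_of_pairwise_lt List.pairwise_lt_range'

theorem avoids132_cons_range'_append_one {n : ℕ} :
    Avoids132 (n :: (List.range' 1 n ++ [1])) := by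
  refine avoids132_cons_of_forall (avoids132_append_singleton_of_forall (avoids132_range' 1 n) ?_) ?_
  · simp only [List.mem_range'_1]
    omega
  · simp only [List.mem_append, List.mem_range'_1, List.mem_singleton]
    omega

theorem representation_of_form {n : ℕ} (hn : 3 ≤ n) {w : List ℕ}
    (h : Form1 n w ∨ Form2 n w ∨ Form3 n w ∨ Form4 n w ∨ Form5 n w ∨ Form6 n w) :
    Avoids132 w ∧ w.toFinset = Finset.Icc 1 n ∧
      ∀ x ∈ Finset.Icc 1 n, ∀ y ∈ Finset.Icc 1 n, y ≠ x → Alternate w x y := by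
  rcases h with rfl | ⟨u, hu, hp, rfl⟩ | rfl | ⟨u, hu, hp, rfl⟩ | ⟨hw, hp⟩ |
    ⟨i, u, hi, hin, hu, hp, rfl⟩
  · obtain ⟨m, rfl⟩ : ∃ m, n = m + 1 + 2 := ⟨n - 3, by omega⟩
    have e : [m + 1 + 2 - 1, m + 1 + 2] ++ (List.range (m + 1 + 2)).map (· + 1) ++ [1] =
        [m + 2, m + 3, 1] ++ List.range' 2 m ++ [m + 2, m + 3, 1] := by
      rw [map_add_range_eq_range', List.range'_concat, List.range'_concat, List.range'_succ]
      simp [Nat.add_left_comm]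
    have hw :
        Avoids132 ([m + 1 + 2 - 1, m + 1 + 2] ++ (List.range (m + 1 + 2)).map (· + 1) ++ [1]) := by
      rw [map_add_range_eq_range']
      refine avoids132_cons_of_forall (avoids132_cons_range'_append_one) ?_
      simp only [List.append_eq, List.mem_cons, List.mem_append, List.mem_range'_1,
        List.not_mem_nil, or_false]
      intros
      omega
    rw [e] at hw ⊢
    refine representation_of_append hw (isPermOf_iff.2 ⟨?_, fun x => ?_⟩)
    · simp [List.nodup_range']
      omega
    · simp only [List.mem_append, List.mem_cons, List.not_mem_nil, or_false, List.mem_range'_1,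
        Finset.mem_Icc]
      omega
  · have hmem := fun x => (hp.mem_iff x)
    simp only [Finset.mem_Icc] at hmem
    refine representation_of_append ?_ (isPermOf_iff.2 ⟨?_, fun x => ?_⟩)
    · have e : [n - 1, n] ++ u ++ [n - 1, n] = (n - 1) :: n :: ((u ++ [n - 1]) ++ [n]) := by simp
      rw [e]
      refine avoids132_cons_of_forall (avoids132_cons_of_forall
        (avoids132_append_singleton_of_forall
          (avoids132_append_singleton_of_forall hu ?_) ?_) ?_) ?_ <;>
      · simp only [List.mem_append, List.mem_cons, List.not_mem_nil, or_false, hmem]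
        intros
        omega
    · simp [hmem, hp.1]
      omega
    · simp only [List.mem_append, List.mem_cons, List.not_mem_nil, or_false, hmem, Finset.mem_Icc]
      omega
  · obtain ⟨m, rfl⟩ : ∃ m, n = m + 1 + 1 := ⟨n - 2, by omega⟩
    have e : (m + 1 + 1) :: ((List.range (m + 1 + 1)).map (· + 1) ++ [1]) =
        [m + 2, 1] ++ List.range' 2 m ++ [m + 2, 1] := by
      rw [map_add_range_eq_range', List.range'_concat, List.range'_succ]
      simp [Nat.add_comm, Nat.add_left_comm]
    have hw : Avoids132 ((m + 1 + 1) :: ((List.range (m + 1 + 1)).map (· + 1) ++ [1])) := by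
      rw [map_add_range_eq_range']
      exact avoids132_cons_range'_append_one
    rw [e] at hw ⊢
    refine representation_of_append hw (isPermOf_iff.2 ⟨?_, fun x => ?_⟩)
    · simp [List.nodup_range']
      omega
    · simp only [List.mem_append, List.mem_cons, List.not_mem_nil, or_false, List.mem_range'_1,
        Finset.mem_Icc]
      omega
  · have hmem := fun x => (hp.mem_iff x)
    simp only [Finset.mem_Icc] at hmem
    refine representation_of_append (v := [n]) ?_ (isPermOf_iff.2 ⟨?_, fun x => ?_⟩)
    · refine avoids132_cons_of_forall (avoids132_append_singleton_of_forall hu ?_) ?_ <;>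
      · simp only [List.append_eq, List.nil_append, List.mem_append, List.mem_cons,
          List.not_mem_nil, or_false, hmem]
        intros
        omega
    · simp [hmem, hp.1]
      omega
    · simp only [List.mem_append, List.mem_cons, List.not_mem_nil, or_false, hmem, Finset.mem_Icc]
      omega
  · simpa using representation_of_append (v := []) (q := w) (by simpa using hw) (by simpa using hp)
  · have hmem := fun x => (hp.mem_iff x)
    simp only [Finset.mem_Icc] at hmem
    have hw : Avoids132 (List.range' i (n - i + 1) ++ u ++ [i]) := by
      rw [avoids132_append_singleton, avoids132_append, List.pairwise_append]
      refine ⟨⟨avoids132_range' _ _, hu, fun z hz => ?_, fun x hx => ?_⟩, ?_, ?_, ?_⟩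
      · refine List.pairwise_of_forall_mem_list fun x hx y _ => ?_
        rw [List.mem_range'_1] at hx
        rw [hmem] at hz
        omega
      · refine List.pairwise_of_forall_mem_list fun y hy z hz => ?_
        rw [List.mem_range'_1] at hx
        rw [hmem] at hz
        omega
      · refine List.pairwise_of_forall_mem_list fun x hx y _ => ?_
        rw [List.mem_range'_1] at hx
        omega
      · refine List.pairwise_of_forall_mem_list fun x _ y hy => ?_
        rw [hmem] at hy
        omega
      · intro x hx
        rw [List.mem_range'_1] at hx
        omega
    have e : List.range' i (n - i + 1) ++ u ++ [i] =
        [i] ++ (List.range' (i + 1) (n - i) ++ u) ++ [i] := by simp [List.range'_succ]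
    rw [map_add_range_eq_range']
    rw [e] at hw ⊢
    refine representation_of_append hw (isPermOf_iff.2 ⟨?_, fun x => ?_⟩)
    · simp only [List.cons_append, List.nil_append, List.nodup_cons, List.nodup_append, hp.1,
        List.mem_append, List.mem_range'_1, hmem, true_and]
      refine ⟨by omega, List.nodup_range', ?_⟩
      intro x hx y hy
      omega
    · simp only [List.mem_append, List.mem_cons, List.not_mem_nil, or_false, hmem, Finset.mem_Icc,
        List.mem_range'_1, or_false]
      omega

/-- The index of the only form that `w` can have, read off its length and first letter. -/
def formIndex (n : ℕ) (w : List ℕ) : Fin 6 :=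
  if w.length = n + 3 then 0
  else if w.length = n + 2 then if w.head? = some (n - 1) then 1 else 2
  else if w.length = n + 1 then if w.head? = some n then 3 else 5
  else 4

theorem eq_formIndex {n : ℕ} (hn : 3 ≤ n) {w : List ℕ} {k : Fin 6}
    (h : [Form1 n w, Form2 n w, Form3 n w, Form4 n w, Form5 n w, Form6 n w].get k) :
    k = formIndex n w := by
  fin_cases k
  · obtain rfl : Form1 n w := h
    simp [formIndex]
  · obtain ⟨u, -, hu, rfl⟩ : Form2 n w := h
    have := hu.length_eq
    rw [Nat.card_Icc] at this
    have hl : ([n - 1, n] ++ u ++ [n - 1, n]).length = n + 2 := by simp; omega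
    rw [formIndex, hl]
    simp
  · obtain rfl : Form3 n w := h
    have : n ≠ n - 1 := by omega
    simp [formIndex, this]
  · obtain ⟨u, -, hu, rfl⟩ : Form4 n w := h
    have := hu.length_eq
    rw [Nat.card_Icc] at this
    have hl : (n :: (u ++ [n])).length = n + 1 := by simp; omega
    rw [formIndex, hl]
    simp
  · obtain ⟨-, hw⟩ : Form5 n w := h
    have hl := hw.length_eq
    rw [Nat.card_Icc, Nat.add_sub_cancel] at hl
    rw [formIndex, hl]
    simp
  · obtain ⟨i, u, hi, hin, -, hu, rfl⟩ : Form6 n w := h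
    have := hu.length_eq
    rw [Nat.card_Icc] at this
    rw [map_add_range_eq_range']
    have hl : (List.range' i (n - i + 1) ++ u ++ [i]).length = n + 1 := by simp; omega
    have hi' : i ≠ n := by omega
    rw [formIndex, hl, List.range'_succ]
    simp [hi']

/-- For `n ≥ 3`, a word with letter set `{1, …, n}` is a 132-avoiding word
representing the complete graph `K n` on `{1, …, n}` iff it has exactly one of the
six forms (i)–(vi). -/
theorem representants_complete_characterization (n : ℕ) (hn : 3 ≤ n) (w : List ℕ) :
    (Avoids132 w ∧ w.toFinset = Finset.Icc 1 n ∧ Represents w (completeOn n)) ↔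
    (∃! k : Fin 6,
      [Form1 n w, Form2 n w, Form3 n w, Form4 n w, Form5 n w, Form6 n w].get k) := by

  have hrep : (Avoids132 w ∧ w.toFinset = Finset.Icc 1 n ∧ Represents w (completeOn n)) ↔
      (Avoids132 w ∧ w.toFinset = Finset.Icc 1 n ∧
        ∀ x ∈ Finset.Icc 1 n, ∀ y ∈ Finset.Icc 1 n, y ≠ x → Alternate w x y) :=
    and_congr_right fun _ => and_congr_right represents_completeOn_iff
  have hform : (∃ k : Fin 6,
      [Form1 n w, Form2 n w, Form3 n w, Form4 n w, Form5 n w, Form6 n w].get k) ↔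
      Form1 n w ∨ Form2 n w ∨ Form3 n w ∨ Form4 n w ∨ Form5 n w ∨ Form6 n w := by
    simp [Fin.exists_fin_succ]
  rw [hrep]
  constructor
  · rintro ⟨hw, hS, h⟩
    obtain ⟨k, hk⟩ := hform.2 (exists_form hn hw hS h)
    exact ⟨k, hk, fun j hj => (eq_formIndex hn hj).trans (eq_formIndex hn hk).symm⟩
  · exact fun h => representation_of_form hn (hform.1 h.exists)
end

section
/- For n ≥ 3, every 132-avoiding word w with A(w) = {1, 2, …, n} representing the complete graph K_n on vertex set {1, 2, …, n} has length equal to n, n+1, n+2, or n+3. -/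
theorem Alternate.mem_of_append {x y : ℕ} {l₁ l₂ l₃ : List ℕ}
    (h : Alternate (l₁ ++ x :: (l₂ ++ x :: l₃)) x y) : y ∈ l₂ := by
  by_contra hy
  unfold Alternate at h
  simp only [List.filter_append, List.filter_cons, true_or, decide_true, if_true] at h
  have h' := (List.isChain_append.1 h).2.1
  cases hl : l₂.filter (fun c => decide (c = x ∨ c = y)) with
  | nil =>
    rw [hl] at h'
    simp at h'
  | cons a t =>
    have ha : a ∈ l₂.filter (fun c => decide (c = x ∨ c = y)) := by
      rw [hl]
      exact List.mem_cons_self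
    rw [List.mem_filter, decide_eq_true_iff] at ha
    rcases ha with ⟨ha, rfl | rfl⟩
    · rw [hl] at h'
      simp at h'
    · exact hy ha

theorem Alternate.exists_between {w : List ℕ} {x y i j : ℕ} (h : Alternate w x y)
    (hij : i < j) (hi : w[i]? = some x) (hj : w[j]? = some x) :
    ∃ k, i < k ∧ k < j ∧ w[k]? = some y := by
  obtain ⟨hi', hix⟩ := List.getElem?_eq_some_iff.1 hi
  obtain ⟨hj', hjx⟩ := List.getElem?_eq_some_iff.1 hj
  have hw : w = w.take i ++ x :: ((w.drop (i + 1)).take (j - i - 1) ++ x :: w.drop (j + 1)) := by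
    have h₁ : w.drop (j + 1) = (w.drop (i + 1)).drop (j - i - 1 + 1) := by
      rw [List.drop_drop]
      congr 1
      omega
    have h₂ : x :: w.drop (j + 1) = (w.drop (i + 1)).drop (j - i - 1) := by
      rw [List.drop_drop, show i + 1 + (j - i - 1) = j by omega, List.drop_eq_getElem_cons hj', hjx]
    rw [h₂, List.take_append_drop]
    conv_lhs => rw [← List.take_append_drop i w, List.drop_eq_getElem_cons hi', hix]
  rw [hw] at h
  obtain ⟨m, hm, hmy⟩ := List.mem_iff_getElem.1 h.mem_of_append
  simp only [List.length_take, List.length_drop] at hm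
  refine ⟨i + 1 + m, by omega, by omega, ?_⟩
  rw [List.getElem_take, List.getElem_drop] at hmy
  exact List.getElem?_eq_some_iff.2 ⟨by omega, hmy⟩

/-- In a word whose letters alternate pairwise, occurrences of the same letter are at least
as far apart as the number of letters. -/
theorem card_le_sub_of_pairwise_alternate {w : List ℕ}
    (h : ∀ x ∈ w, ∀ y ∈ w, x ≠ y → Alternate w x y) {i j x : ℕ} (hij : i < j)
    (hi : w[i]? = some x) (hj : w[j]? = some x) : w.toFinset.card ≤ j - i := by
  have hx : x ∈ w := List.mem_of_getElem? hi
  have hsub : w.toFinset.erase x ⊆ (Finset.Ioo i j).image (fun k => w[k]?.getD 0) := by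
    intro y hy
    simp only [Finset.mem_erase, List.mem_toFinset] at hy
    obtain ⟨k, hk, hk', hky⟩ := (h x hx y hy.2 hy.1.symm).exists_between hij hi hj
    exact Finset.mem_image.2 ⟨k, Finset.mem_Ioo.2 ⟨hk, hk'⟩, by simp [hky]⟩
  have hcard := (Finset.card_le_card hsub).trans Finset.card_image_le
  rw [Finset.card_erase_of_mem (List.mem_toFinset.2 hx), Nat.card_Ioo] at hcard
  omega

theorem getElem_add_card_of_pairwise_alternate {w : List ℕ}
    (h : ∀ x ∈ w, ∀ y ∈ w, x ≠ y → Alternate w x y) {i : ℕ}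
    (hi : i + w.toFinset.card < w.length) : w[i + w.toFinset.card] = w[i] := by
  have hmaps : ∀ k ∈ Finset.Icc i (i + w.toFinset.card), w[k]?.getD 0 ∈ w.toFinset := by
    intro k hk
    have hk' : k < w.length := by
      have := (Finset.mem_Icc.1 hk).2
      omega
    simp [hk']
  obtain ⟨a, ha, b, hb, hab, heq⟩ := Finset.exists_ne_map_eq_of_card_lt_of_maps_to
    (by rw [Nat.card_Icc]; omega) hmaps
  simp only [Finset.mem_Icc] at ha hb
  have ha' : a < w.length := by omega
  have hb' : b < w.length := by omega
  simp only [List.getElem?_eq_getElem ha', List.getElem?_eq_getElem hb', Option.getD_some] at heq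
  rcases lt_or_gt_of_ne hab with hlt | hlt
  · have := card_le_sub_of_pairwise_alternate h hlt (List.getElem?_eq_getElem ha')
      (by rw [List.getElem?_eq_getElem hb', heq])
    obtain rfl : a = i := by omega
    obtain rfl : b = a + w.toFinset.card := by omega
    exact heq.symm
  · have := card_le_sub_of_pairwise_alternate h hlt (List.getElem?_eq_getElem hb')
      (by rw [List.getElem?_eq_getElem ha', heq])
    obtain rfl : b = i := by omega
    obtain rfl : a = b + w.toFinset.card := by omega
    exact heq

/-- Three consecutive letters that are repeated one period later form the pattern 231. -/
theorem Avoids132.lt_and_lt_of_pairwise_alternate {w : List ℕ} (hw : Avoids132 w)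
    (h : ∀ x ∈ w, ∀ y ∈ w, x ≠ y → Alternate w x y) (hc : 3 ≤ w.toFinset.card) {i : ℕ}
    (hi : i + 2 + w.toFinset.card < w.length) : w[i + 2] < w[i] ∧ w[i] < w[i + 1] := by
  have hne : ∀ a b (hab : a < b) (hb : b < w.length), b < a + 3 → w[a] ≠ w[b] := by
    intro a b hab hb hlt heq
    have := card_le_sub_of_pairwise_alternate h hab
      (List.getElem?_eq_getElem (hab.trans hb)) (by rw [List.getElem?_eq_getElem hb, heq])
    omega
  have av : ∀ a b c (hab : a < b) (hbc : b < c) (hc : c < w.length),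
      ¬ (w[a] < w[c] ∧ w[c] < w[b]) := fun a b c hab hbc hc =>
    hw ⟨a, by omega⟩ ⟨b, by omega⟩ ⟨c, hc⟩ hab hbc
  have p₀ := getElem_add_card_of_pairwise_alternate h (i := i) (by omega)
  have p₁ := getElem_add_card_of_pairwise_alternate h (i := i + 1) (by omega)
  have p₂ := getElem_add_card_of_pairwise_alternate h (i := i + 2) hi
  have d₀₁ := hne i (i + 1) (by omega) (by omega) (by omega)
  have d₀₂ := hne i (i + 2) (by omega) (by omega) (by omega)
  have d₁₂ := hne (i + 1) (i + 2) (by omega) (by omega) (by omega)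
  have a₀₁₂ := av i (i + 1) (i + 2) (by omega) (by omega) (by omega)
  have a₁₂₀ := av (i + 1) (i + 2) (i + w.toFinset.card) (by omega) (by omega) (by omega)
  have a₂₀₁ := av (i + 2) (i + w.toFinset.card) (i + 1 + w.toFinset.card)
    (by omega) (by omega) (by omega)
  have a₀₂₁ := av i (i + 2) (i + 1 + w.toFinset.card) (by omega) (by omega) (by omega)
  have a₁₀₂ := av (i + 1) (i + w.toFinset.card) (i + 2 + w.toFinset.card)
    (by omega) (by omega) (by omega)
  simp only [p₀, p₁, p₂] at a₁₂₀ a₂₀₁ a₀₂₁ a₁₀₂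
  omega

/-- For `n ≥ 3`, every 132-avoiding word with letter set `{1, …, n}` representing
the complete graph `K n` has length `n`, `n+1`, `n+2`, or `n+3`. -/
theorem representant_complete_length (n : ℕ) (hn : 3 ≤ n) (w : List ℕ)
    (hw : Avoids132 w) (hset : w.toFinset = Finset.Icc 1 n)
    (hrep : Represents w (completeOn n)) :
    w.length = n ∨ w.length = n + 1 ∨ w.length = n + 2 ∨ w.length = n + 3 := by
  have hcard : w.toFinset.card = n := by simp [hset]
  have hle : n ≤ w.length := hcard ▸ w.toFinset_card_le
  have hmem : ∀ x ∈ w, 1 ≤ x ∧ x ≤ n := fun x hx => by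
    rwa [← List.mem_toFinset, hset, Finset.mem_Icc] at hx
  have halt : ∀ x ∈ w, ∀ y ∈ w, x ≠ y → Alternate w x y := by
    intro x hx y hy hxy
    refine (hrep.2 x y hxy hx hy).1 ?_
    have := hmem x hx
    have := hmem y hy
    simp only [completeOn, SimpleGraph.fromRel_adj]
    tauto
  by_contra hlen
  have h₀ := hw.lt_and_lt_of_pairwise_alternate halt (by omega) (i := 0) (by omega)
  have h₁ := hw.lt_and_lt_of_pairwise_alternate halt (by omega) (i := 1) (by omega)
  simp only [Nat.reduceAdd] at h₀ h₁
  omega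
end

section
/- Let G be a finite simple graph and let G′ be the graph obtained from G by adding one new isolated vertex (so G′ is the disjoint union of G with a single vertex having no edges). Then G is 132-representable if and only if G′ is 132-representable. -/
theorem Avoids132.sublist {v w : List ℕ} (hw : Avoids132 w) (h : v.Sublist w) :
    Avoids132 v := by
  obtain ⟨f, hf⟩ := List.sublist_iff_exists_fin_orderEmbedding_get_eq.1 h
  intro i j k hij hjk
  rw [hf, hf, hf]
  exact hw _ _ _ (f.lt_iff_lt.2 hij) (f.lt_iff_lt.2 hjk)

theorem Avoids132.append_of_le {w u : List ℕ} (hw : Avoids132 w) {z : ℕ}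
    (hwz : ∀ x ∈ w, x ≤ z) (hu : ∀ x ∈ u, x = z) : Avoids132 (w ++ u) := by
  rintro ⟨i, hi⟩ ⟨j, hj⟩ ⟨k, hk⟩ hij hjk ⟨hik, hkj⟩
  simp only [Fin.mk_lt_mk, List.get_eq_getElem] at hij hjk hik hkj
  have hjz : (w ++ u)[j] ≤ z := by
    rcases List.mem_append.1 (List.getElem_mem hj) with h | h
    · exact hwz _ h
    · exact (hu _ h).le
  rcases lt_or_ge k w.length with h | h
  · rw [List.getElem_append_left (by omega), List.getElem_append_left (by omega)] at hik hkj
    exact hw ⟨i, by omega⟩ ⟨j, by omega⟩ ⟨k, h⟩ hij hjk ⟨hik, hkj⟩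
  · have hkz : (w ++ u)[k] = z := by
      rw [List.getElem_append_right h]
      exact hu _ (List.getElem_mem _)
    omega

theorem alternate_comm {w : List ℕ} {x y : ℕ} : Alternate w x y ↔ Alternate w y x := by
  simp only [Alternate, or_comm]

theorem alternate_filter_ne {w : List ℕ} {x y z : ℕ} (hx : x ≠ z) (hy : y ≠ z) :
    Alternate (w.filter (fun c => decide (c ≠ z))) x y ↔ Alternate w x y := by
  unfold Alternate
  rw [List.filter_filter]
  have h : ∀ c ∈ w, (decide (c = x ∨ c = y) && decide (c ≠ z)) = decide (c = x ∨ c = y) := by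
    intro c _
    grind
  rw [List.filter_congr h]

theorem alternate_append_pair {w : List ℕ} {x y z : ℕ} (hx : x ≠ z) (hy : y ≠ z) :
    Alternate (w ++ [z, z]) x y ↔ Alternate w x y := by
  simp [Alternate, List.filter_append, hx.symm, hy.symm]

theorem not_alternate_append_pair (w : List ℕ) (x z : ℕ) :
    ¬ Alternate (w ++ [z, z]) x z := by
  intro h
  rw [Alternate, List.filter_append] at h
  have h' := (List.isChain_append.1 h).2.1
  simp at h'

/-- Representability in terms of an injective labelling of the vertices by letters. -/
theorem representable132_iff_labelling {V : Type*} {G : SimpleGraph V} :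
    Representable132 G ↔ ∃ (w : List ℕ) (f : V → ℕ), Avoids132 w ∧ Function.Injective f ∧
      (∀ n, n ∈ w ↔ ∃ v, f v = n) ∧
      ∀ u v, u ≠ v → (G.Adj u v ↔ Alternate w (f u) (f v)) := by
  constructor
  · rintro ⟨w, H, hw, ⟨-, hH⟩, ⟨e⟩⟩
    have hmem : ∀ v, (e v : ℕ) ∈ w := fun v => by simpa using (e v).2
    have hinj : Function.Injective fun v => (e v : ℕ) :=
      Subtype.val_injective.comp e.injective
    refine ⟨w, fun v => e v, hw, hinj, fun n => ⟨fun hn => ?_, ?_⟩, fun u v huv => ?_⟩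
    · exact ⟨e.symm ⟨n, by simpa using hn⟩, by simp⟩
    · rintro ⟨v, rfl⟩
      exact hmem v
    · rw [← hH _ _ (hinj.ne huv) (hmem u) (hmem v), ← e.map_adj_iff]
      rfl
  · rintro ⟨w, f, hw, hf, hmem, hadj⟩
    have hfmem : ∀ v, f v ∈ w := fun v => (hmem _).2 ⟨v, rfl⟩
    refine ⟨w, G.map f, hw, ⟨?_, ?_⟩, ⟨⟨Equiv.ofBijective
      (fun v => ⟨f v, by simpa using hfmem v⟩) ⟨?_, ?_⟩, ?_⟩⟩⟩
    · intro x y h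
      obtain ⟨-, u, v, -, rfl, -⟩ := h
      exact hfmem u
    · intro x y hxy hx hy
      obtain ⟨u, rfl⟩ := (hmem x).1 hx
      obtain ⟨v, rfl⟩ := (hmem y).1 hy
      rw [← hadj u v (fun h => hxy (congrArg f h))]
      exact SimpleGraph.map_adj_apply (f := (⟨f, hf⟩ : V ↪ ℕ))
    · intro u v h
      exact hf (Subtype.ext_iff.1 h)
    · rintro ⟨n, hn⟩
      obtain ⟨v, rfl⟩ := (hmem n).1 (by simpa using hn)
      exact ⟨v, rfl⟩
    · intro u v
      exact SimpleGraph.map_adj_apply (f := (⟨f, hf⟩ : V ↪ ℕ))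

/-- If `G'` is obtained from a finite simple graph `G` by adding one new isolated
vertex, then `G` is 132-representable iff `G'` is 132-representable. -/
theorem representable132_add_isolated {V : Type*} [Fintype V] (G : SimpleGraph V)
    (G' : SimpleGraph (Option V))
    (hG' : ∀ a b, G'.Adj a b ↔ ∃ u v, a = some u ∧ b = some v ∧ G.Adj u v) :
    Representable132 G ↔ Representable132 G' := by
  have hsome : ∀ u v, G'.Adj (some u) (some v) ↔ G.Adj u v := by simp [hG']
  have hnone : ∀ a, ¬ G'.Adj a none := by simp [hG']
  rw [representable132_iff_labelling, representable132_iff_labelling]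
  constructor
  · rintro ⟨w, f, hw, hf, hmem, hadj⟩
    obtain ⟨z, hz⟩ : ∃ z, ∀ x ∈ w, x < z :=
      ⟨w.sum + 1, fun x hx => Nat.lt_succ_of_le (List.le_sum_of_mem hx)⟩
    have hfz : ∀ v, f v ≠ z := fun v => (hz _ ((hmem _).2 ⟨v, rfl⟩)).ne
    refine ⟨w ++ [z, z], fun a => a.elim z f,
      hw.append_of_le (fun x hx => (hz x hx).le) (by simp), ?_, ?_, ?_⟩
    · rintro (_ | u) (_ | v) h
      · rfl
      · exact absurd h.symm (hfz v)
      · exact absurd h (hfz u)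
      · exact congrArg some (hf h)
    · intro n
      simp [Option.exists, hmem, or_comm, eq_comm]
    · rintro (_ | u) (_ | v) huv
      · exact absurd rfl huv
      · rw [G'.adj_comm, alternate_comm]
        exact iff_of_false (hnone _) (not_alternate_append_pair w _ z)
      · exact iff_of_false (hnone _) (not_alternate_append_pair w _ z)
      · rw [hsome, hadj u v (fun h => huv (congrArg some h))]
        exact (alternate_append_pair (hfz u) (hfz v)).symm
  · rintro ⟨w, f, hw, hf, hmem, hadj⟩
    have hfz : ∀ v, f (some v) ≠ f none := fun v => hf.ne (Option.some_ne_none v)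
    refine ⟨w.filter (fun c => decide (c ≠ f none)), fun v => f (some v),
      hw.sublist List.filter_sublist, hf.comp (Option.some_injective V), ?_, ?_⟩
    · intro n
      rw [List.mem_filter, hmem, Option.exists]
      grind
    · intro u v huv
      rw [alternate_filter_ne (hfz u) (hfz v), ← hsome]
      exact hadj _ _ (fun h => huv (Option.some_injective V h))
end
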